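/- Let N ≥ 3 be an integer, ω := e^{−2πi/N}, and for 0 ≤ k ≤ N−2 let P_k(A₁,…,A_N | B) := Σ_{j=0}^{k} ω^{−j(j−1)/2} [k choose j]_{ω^{−1}} B^{−j} · ∏_{a=1}^{N−j−1} A_a^{a} · ∏_{a=N−j}^{N−1} A_a^{a+1} · A_N^{N+1}, where [k choose j]_{ω^{−1}} is the q-binomial coefficient with q = ω^{−1}. Then for all nonzero complex numbers A₁,…,A_N, B: Skew( P_{N−2}(A₁,…,A_N | ωB) ) = Skew( ∏_{a=1}^{N−1}(1−B^{−1}A_a)(1−ωB^{−1}A_a) · P₀(A₁,…,A_N | B) ), where Skew denotes the skew-symmetrization Σ_{σ∈S_N} sgn(σ)·f(A_{σ(1)},…,A_{σ(N)}) with respect to A₁,…,A_N. -/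

import Mathlib

open Finset

noncomputable section

/-- The `q`-binomial coefficient `[k choose j]` with `q = ω⁻¹`,
`[k choose j] = ∏_{i=1}^{j} (1−ω^{−(k−i+1)})/(1−ω^{−i})`. -/
def qbin (ω : ℂ) (k j : ℕ) : ℂ :=
  ∏ i ∈ Finset.Icc 1 j, (1 - ω ^ (-((k : ℤ) - (i : ℤ) + 1))) / (1 - ω ^ (-(i : ℤ)))

/-- The function `P_k(A₁,…,A_N | B)` of Section 7.3.  The tuple `A : Fin N → ℂ` is
0-indexed: `A ⟨a-1⟩` plays the role of `A_a` for `1 ≤ a ≤ N`. -/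
def Pfun (N : ℕ) (ω : ℂ) (k : ℕ) (A : Fin N → ℂ) (B : ℂ) : ℂ :=
  ∑ j ∈ Finset.range (k + 1),
    ω ^ (-((j * (j - 1) / 2 : ℕ) : ℤ)) * qbin ω k j * B ^ (-(j : ℤ)) *
      ∏ a : Fin N,
        A a ^ (if (a : ℕ) < N - 1 - j then (a : ℕ) + 1
          else if (a : ℕ) < N - 1 then (a : ℕ) + 2 else N + 1)

/-- Skew-symmetrization with respect to the variables `A₁,…,A_N`. -/
def skewA {N : ℕ} (f : (Fin N → ℂ) → ℂ) (A : Fin N → ℂ) : ℂ :=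
  ∑ σ : Equiv.Perm (Fin N), ((Equiv.Perm.sign σ : ℤ) : ℂ) * f (A ∘ σ)

/-- The skew-symmetrization of a product of one-variable functions is a determinant. -/
lemma skewA_prod {N : ℕ} (g : Fin N → ℂ → ℂ) (A : Fin N → ℂ) :
    skewA (fun A' => ∏ a, g a (A' a)) A = (Matrix.of fun a b => g a (A b)).det := by
  rw [← Matrix.det_transpose, Matrix.det_apply']
  rfl

lemma skewA_sum {N : ℕ} {ι : Type*} (s : Finset ι) (c : ι → ℂ) (f : ι → (Fin N → ℂ) → ℂ)
    (A : Fin N → ℂ) :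
    skewA (fun A' => ∑ j ∈ s, c j * f j A') A = ∑ j ∈ s, c j * skewA (f j) A := by
  simp only [skewA, Finset.mul_sum]
  rw [Finset.sum_comm]
  exact Finset.sum_congr rfl fun _ _ => Finset.sum_congr rfl fun _ _ => by ring

/-- At a primitive `N`-th root of unity the coefficients of `Pfun` of order `N - 2` reduce to
geometric sums. -/
lemma coeff_eq_geom_sum {N : ℕ} {ω : ℂ} (hω : IsPrimitiveRoot ω N) {B : ℂ} (hB : B ≠ 0)
    (j : ℕ) (hj : j + 2 ≤ N) :
    ω ^ (-((j * (j - 1) / 2 : ℕ) : ℤ)) * qbin ω (N - 2) j * (ω * B) ^ (-(j : ℤ)) =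
      (-1) ^ j * ((∑ t ∈ range (j + 1), ω ^ t) * B⁻¹ ^ j) := by
  have h0 : ω ≠ 0 := hω.ne_zero (by omega)
  induction j with
  | zero => simp [qbin]
  | succ j ih =>
    have ih := ih (by omega)
    have h1 : ω ^ (j + 1) ≠ 1 := hω.pow_ne_one_of_pos_of_lt (by omega) (by omega)
    have hω1 : ω ≠ 1 := hω.ne_one (by omega)
    have hq : qbin ω (N - 2) (j + 1) = qbin ω (N - 2) j *
        (-ω ^ (j + 1) * (1 - ω ^ (j + 2)) / (1 - ω ^ (j + 1))) := by
      unfold qbin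
      rw [Finset.prod_Icc_succ_top (by omega)]
      congr 1
      have e : ω ^ (-(((N - 2 : ℕ) : ℤ) - ((j + 1 : ℕ) : ℤ) + 1)) = ω ^ (j + 2) := by
        have e1 : -(((N - 2 : ℕ) : ℤ) - ((j + 1 : ℕ) : ℤ) + 1) = ((j + 2 : ℕ) : ℤ) - (N : ℤ) := by
          push_cast [Nat.cast_sub (show 2 ≤ N by omega)]
          ring
        rw [e1, zpow_sub₀ h0, zpow_natCast, zpow_natCast, hω.pow_eq_one, div_one]
      rw [e, zpow_neg, zpow_natCast]
      have h2 : 1 - ω ^ (j + 1) ≠ 0 := sub_ne_zero.mpr h1.symm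
      have h3 : ω ^ (j + 1) ≠ 0 := pow_ne_zero _ h0
      have h4 : 1 - (ω ^ (j + 1))⁻¹ ≠ 0 := by
        rw [sub_ne_zero]
        intro h
        exact h1 (inv_eq_one.mp h.symm)
      rw [div_eq_div_iff h4 h2]
      field_simp
      ring
    have ht : (j + 1) * (j + 1 - 1) / 2 = j * (j - 1) / 2 + j := by
      rw [← Nat.triangle_succ]
    have hg : (∑ t ∈ range (j + 2), ω ^ t) * (1 - ω ^ (j + 1)) =
        (∑ t ∈ range (j + 1), ω ^ t) * (1 - ω ^ (j + 2)) := by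
      rw [geom_sum_eq hω1, geom_sum_eq hω1]
      ring
    rw [hq, ht]
    have h2 : 1 - ω ^ (j + 1) ≠ 0 := sub_ne_zero.mpr h1.symm
    have hz : (ω * B) ^ (-((j + 1 : ℕ) : ℤ)) = (ω * B) ^ (-(j : ℤ)) * (ω⁻¹ * B⁻¹) := by
      rw [zpow_neg, zpow_neg, zpow_natCast, zpow_natCast, pow_succ, mul_inv, mul_inv ω B]
    have hz' : ω ^ (-((j * (j - 1) / 2 + j : ℕ) : ℤ)) =
        ω ^ (-((j * (j - 1) / 2 : ℕ) : ℤ)) * (ω ^ j)⁻¹ := by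
      rw [zpow_neg, zpow_neg, zpow_natCast, zpow_natCast, pow_add, mul_inv]
    have e2 : (∑ t ∈ range (j + 2), ω ^ t) =
        (∑ t ∈ range (j + 1), ω ^ t) * (1 - ω ^ (j + 2)) / (1 - ω ^ (j + 1)) := by
      rw [eq_div_iff h2, hg]
    rw [hz, hz', e2]
    have h3 : ω ^ j ≠ 0 := pow_ne_zero _ h0
    calc _ = (ω ^ (-((j * (j - 1) / 2 : ℕ) : ℤ)) * qbin ω (N - 2) j * (ω * B) ^ (-(j : ℤ))) *
          ((ω ^ j)⁻¹ * (-ω ^ (j + 1) * (1 - ω ^ (j + 2)) / (1 - ω ^ (j + 1))) *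
            (ω⁻¹ * B⁻¹)) := by ring
      _ = _ := by
        rw [ih, show (ω ^ j)⁻¹ * (-ω ^ (j + 1) * (1 - ω ^ (j + 2)) / (1 - ω ^ (j + 1))) *
            (ω⁻¹ * B⁻¹) = -((1 - ω ^ (j + 2)) / (1 - ω ^ (j + 1)) * B⁻¹) by
          rw [pow_succ ω j]
          field_simp]
        ring

/-- Adding `p` times the next row and `q` times the row after it to every row but the last two does
not change the determinant. -/
lemma det_add_smul_next_two_rows {N : ℕ} (p q : ℂ) (G : Fin (N + 1) → ℕ → ℂ) :
    (Matrix.of fun (i c : Fin (N + 1)) => G c i).det =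
      (Matrix.of fun (i c : Fin (N + 1)) =>
        if (i : ℕ) + 2 ≤ N then G c i + p * G c (i + 1) + q * G c (i + 2) else G c i).det := by
  let L : Matrix (Fin (N + 1)) (Fin (N + 1)) ℂ := Matrix.of fun i k =>
    (if (k : ℕ) = i then 1 else 0) +
    (if (k : ℕ) = i + 1 then if (i : ℕ) + 2 ≤ N then p else 0 else 0) +
    (if (k : ℕ) = i + 2 then if (i : ℕ) + 2 ≤ N then q else 0 else 0)
  have hL : L.det = 1 := by
    rw [Matrix.det_of_isUpperTriangular]
    · simp [L]
    · intro i k hik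
      have hik : (k : ℕ) < i := hik
      simp only [L, Matrix.of_apply]
      rw [if_neg (by omega), if_neg (by omega), if_neg (by omega)]
      simp
  rw [← one_mul (Matrix.det _), ← hL, ← Matrix.det_mul]
  congr 1
  ext i c
  simp only [Matrix.mul_apply, Matrix.of_apply, L]
  rw [Fin.sum_univ_eq_sum_range (fun k => ((if k = (i : ℕ) then (1 : ℂ) else 0) +
    (if k = (i : ℕ) + 1 then if (i : ℕ) + 2 ≤ N then p else 0 else 0) +
    (if k = (i : ℕ) + 2 then if (i : ℕ) + 2 ≤ N then q else 0 else 0)) * G c k) (N + 1)]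
  simp only [add_mul, Finset.sum_add_distrib, ite_mul, zero_mul, one_mul, Finset.sum_ite_eq',
    Finset.mem_range]
  have := i.isLt
  split_ifs <;> first | omega | simp

/-- The alternating sum of the generalized Vandermonde determinants that omit one exponent, with
complete homogeneous weights in `x` and `ω * x`. -/
lemma sum_det_succAbove {N : ℕ} (hN : 1 ≤ N) (ω x : ℂ) (A : Fin N → ℂ) :
    ∑ i : Fin (N + 1), (-1) ^ (i : ℕ) *
        ((∑ t ∈ range (N - i), ω ^ t) * x ^ (N - 1 - i)) *
        (Matrix.of fun a b => A b ^ ((i.succAbove a : ℕ) + 1)).det =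
      (-1) ^ (N - 1) * (Matrix.of fun (a b : Fin N) =>
        if (a : ℕ) < N - 1 then (1 - x * A b) * (1 - ω * x * A b) * A b ^ ((a : ℕ) + 1)
        else A b ^ (N + 1)).det := by
  let G : Fin (N + 1) → ℕ → ℂ := Fin.cons
    (fun k => (∑ t ∈ range (N - k), ω ^ t) * x ^ (N - 1 - k)) (fun b k => A b ^ (k + 1))
  have key := det_add_smul_next_two_rows (-((1 + ω) * x)) (ω * x ^ 2) G
  rw [Matrix.det_succ_column_zero, Matrix.det_succ_column_zero] at key
  refine Eq.trans ?_ (key.trans ?_)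
  · refine Finset.sum_congr rfl fun i _ => ?_
    rfl
  · rw [Finset.sum_eq_single (⟨N - 1, by omega⟩ : Fin (N + 1))]
    · have h1 : ¬ (N - 1 + 2 ≤ N) := by omega
      have h2 : N - (N - 1) = 1 := by omega
      simp only [Matrix.of_apply, if_neg h1, G, Fin.cons_zero, h2, Nat.sub_self]
      simp only [range_one, sum_singleton, pow_zero, mul_one]
      congr 2
      ext a b
      simp only [Matrix.submatrix_apply, Matrix.of_apply, Fin.cons_succ]
      have ha := a.isLt
      by_cases h : (a : ℕ) < N - 1
      · rw [Fin.succAbove_of_castSucc_lt _ _ (by simpa [Fin.lt_def] using h)]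
        simp only [Fin.val_castSucc]
        rw [if_pos (by omega), if_pos h]
        ring
      · rw [Fin.succAbove_of_le_castSucc _ _ (by simpa [Fin.le_def] using h)]
        simp only [Fin.val_succ]
        rw [if_neg (by omega), if_neg h, show (a : ℕ) + 1 + 1 = N + 1 by omega]
    · intro i _ hi
      have hlt := i.isLt
      have hi' : (i : ℕ) ≠ N - 1 := fun h => hi (Fin.ext h)
      simp only [Matrix.of_apply, G, Fin.cons_zero]
      by_cases h : (i : ℕ) + 2 ≤ N
      · rw [if_pos h]
        obtain ⟨m, hm⟩ := Nat.exists_eq_add_of_le h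
        have e0 : N - (i : ℕ) = m + 2 := by omega
        have e1 : N - ((i : ℕ) + 1) = m + 1 := by omega
        have e2 : N - ((i : ℕ) + 2) = m := by omega
        have f0 : N - 1 - (i : ℕ) = m + 1 := by omega
        have f1 : N - 1 - ((i : ℕ) + 1) = m := by omega
        rw [e0, e1, e2, f0, f1]
        suffices hz : (∑ t ∈ range (m + 2), ω ^ t) * x ^ (m + 1) +
            -((1 + ω) * x) * ((∑ t ∈ range (m + 1), ω ^ t) * x ^ m) +
            ω * x ^ 2 * ((∑ t ∈ range m, ω ^ t) * x ^ (N - 1 - ((i : ℕ) + 2))) = 0 by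
          rw [hz]
          simp
        rcases m with _ | m
        · simp [Finset.sum_range_succ]
        · have f2 : N - 1 - ((i : ℕ) + 2) = m := by omega
          rw [f2]
          simp only [Finset.sum_range_succ]
          ring
      · rw [if_neg h, show N - (i : ℕ) = 0 by omega]
        simp
    · simp

/-- Lemma `skew3`:
`Skew(P_{N−2}(A|ωB)) = Skew(∏_{a=1}^{N−1}(1−B⁻¹A_a)(1−ωB⁻¹A_a) · P₀(A|B))`
with `ω = e^{−2πi/N}`. -/
theorem statement16 (N : ℕ) (hN : 3 ≤ N) (ω : ℂ)
    (hω : ω = Complex.exp (-(2 * (Real.pi : ℂ) * Complex.I) / (N : ℂ)))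
    (A : Fin N → ℂ) (B : ℂ) (hA : ∀ a, A a ≠ 0) (hB : B ≠ 0) :
    skewA (fun A' => Pfun N ω (N - 2) A' (ω * B)) A =
      skewA (fun A' =>
        (∏ a ∈ Finset.univ.filter fun a : Fin N => (a : ℕ) < N - 1,
            ((1 - B⁻¹ * A' a) * (1 - ω * B⁻¹ * A' a))) *
          Pfun N ω 0 A' B) A := by
  have hprim : IsPrimitiveRoot ω N := by
    have h := (Complex.isPrimitiveRoot_exp N (by omega)).inv
    rw [← Complex.exp_neg, ← neg_div, ← hω] at h
    exact h
  have key := sum_det_succAbove (show 1 ≤ N by omega) ω B⁻¹ A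
  have hleft : skewA (fun A' => Pfun N ω (N - 2) A' (ω * B)) A =
      ∑ j ∈ range (N - 1), (-1) ^ j * ((∑ t ∈ range (j + 1), ω ^ t) * B⁻¹ ^ j) *
        (Matrix.of fun (a b : Fin N) => A b ^ (if (a : ℕ) < N - 1 - j then (a : ℕ) + 1
          else if (a : ℕ) < N - 1 then (a : ℕ) + 2 else N + 1)).det := by
    unfold Pfun
    rw [skewA_sum, show N - 2 + 1 = N - 1 by omega]
    refine Finset.sum_congr rfl fun j hj => ?_
    rw [Finset.mem_range] at hj
    rw [coeff_eq_geom_sum hprim hB j (by omega), skewA_prod (fun a z => z ^ _) A]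
  have hright : skewA (fun A' =>
        (∏ a ∈ Finset.univ.filter fun a : Fin N => (a : ℕ) < N - 1,
            ((1 - B⁻¹ * A' a) * (1 - ω * B⁻¹ * A' a))) *
          Pfun N ω 0 A' B) A = (Matrix.of fun (a b : Fin N) =>
        if (a : ℕ) < N - 1 then (1 - B⁻¹ * A b) * (1 - ω * B⁻¹ * A b) * A b ^ ((a : ℕ) + 1)
        else A b ^ (N + 1)).det := by
    rw [← skewA_prod (fun a z => if (a : ℕ) < N - 1 then
      (1 - B⁻¹ * z) * (1 - ω * B⁻¹ * z) * z ^ ((a : ℕ) + 1) else z ^ (N + 1)) A]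
    congr 1
    funext A'
    simp only [Pfun, zero_add, range_one, sum_singleton, qbin]
    rw [Finset.prod_filter]
    simp only [Nat.zero_mul, Nat.zero_div, Nat.cast_zero, neg_zero, zpow_zero, one_mul,
      Finset.Icc_eq_empty_of_lt Nat.zero_lt_one, Finset.prod_empty, Nat.sub_zero]
    rw [← Finset.prod_mul_distrib]
    refine Finset.prod_congr rfl fun a _ => ?_
    split_ifs <;> simp
  rw [hleft, hright]
  have hsq : ((-1 : ℂ) ^ (N - 1)) * (-1) ^ (N - 1) = 1 := by
    rw [← mul_pow]
    simp
  refine Eq.trans ?_ ((congrArg ((-1 : ℂ) ^ (N - 1) * ·) key).trans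
    (by rw [← mul_assoc, hsq, one_mul]))
  obtain ⟨n, rfl⟩ : ∃ n, N = n + 1 := ⟨N - 1, by omega⟩
  simp only [Nat.add_sub_cancel]
  rw [Fin.sum_univ_succ, Fin.sum_univ_castSucc, ← Equiv.sum_comp Fin.revPerm, Finset.sum_range]
  have hfirst : ∑ t ∈ range (n + 1 - ((0 : Fin (n + 2)) : ℕ)), ω ^ t = 0 := by
    simpa using hprim.geom_sum_eq_zero (by omega)
  have hlast : ∑ t ∈ range (n + 1 - ((Fin.last n).succ : ℕ)), ω ^ t = 0 := by
    simp
  rw [hfirst, hlast]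
  simp only [zero_mul, mul_zero, add_zero, zero_add, Finset.mul_sum]
  refine Finset.sum_congr rfl fun j _ => ?_
  have hj := j.isLt
  have hv : ((Fin.revPerm j).castSucc.succ : ℕ) = n - j := by
    simp only [Fin.revPerm_apply, Fin.val_succ, Fin.val_castSucc, Fin.val_rev]
    omega
  have hmat : (Matrix.of fun (a b : Fin (n + 1)) => A b ^ (if (a : ℕ) < n - j then (a : ℕ) + 1
      else if (a : ℕ) < n then (a : ℕ) + 2 else n + 1 + 1)) =
      Matrix.of fun a b => A b ^ (((Fin.revPerm j).castSucc.succ.succAbove a : ℕ) + 1) := by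
    ext a b
    have ha := a.isLt
    simp only [Matrix.of_apply, Fin.succAbove, Fin.lt_def, hv, Fin.val_castSucc]
    congr 1
    split_ifs <;> simp only [Fin.val_castSucc, Fin.val_succ] <;> omega
  have hsign : (-1 : ℂ) ^ n * (-1) ^ (n - (j : ℕ)) = (-1) ^ (j : ℕ) := by
    rw [← pow_add, show n + (n - (j : ℕ)) = 2 * (n - j) + j by omega, pow_add, pow_mul]
    simp
  rw [hmat, hv, show n + 1 - (n - (j : ℕ)) = j + 1 by omega,
    show n - (n - (j : ℕ)) = j by omega, ← hsign]
  ring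

end
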